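/- Fix an integer k ≥ 1. Let x ∈ (0,1) be irrational and let p/q ∈ ℚ ∩ (0,1) with gcd(p,q) = 1 and q > 0, and suppose k/(k+1) ≤ q·|q x − p| < (k+1)/(k+2). Then one of the following holds: (i) there exists j ≥ 1 such that p/q = p_{j−1}/q_{j−1}, a_j = 1 and a_{j+1} ≥ k; (ii) there exists j ≥ 0 with a_{j+1} ≤ k+1 such that p/q = (p_j + p_{j−1})/(q_j + q_{j−1}); (iii) there exists j ≥ 0 with a_{j+1} ≤ k+1 such that p/q = ((a_{j+1} − 1) p_j + p_{j−1})/((a_{j+1} − 1) q_j + q_{j−1}). -/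

import Mathlib

open MeasureTheory Filter Topology
open scoped Classical

noncomputable section

/-- The Farey tent map `F`. -/
def fareyMap (x : ℝ) : ℝ := if x ≤ 1/2 then x / (1 - x) else (1 - x) / x

/-- `eps x n = ε_{n+1}(x)`, i.e. `0` if `F^[n] x ≤ 1/2` and `1` otherwise. -/
def eps (x : ℝ) (n : ℕ) : ℤ := if fareyMap^[n] x ≤ 1/2 then 0 else 1

/-- The matrices `A_0 = [[1,0],[1,1]]` and `A_1 = [[0,1],[1,1]]`. -/
def Amat (e : ℤ) : Matrix (Fin 2) (Fin 2) ℤ := !![1 - e, e; 1, 1]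

/-- `Mmat x n = A_{ε_1(x)} ⋯ A_{ε_n(x)}`, with `Mmat x 0` the identity. -/
def Mmat (x : ℝ) : ℕ → Matrix (Fin 2) (Fin 2) ℤ
  | 0 => 1
  | n + 1 => Mmat x n * Amat (eps x n)

/-- `u_n(x)`: top-left entry of `M_n(x)`. -/
def uF (x : ℝ) (n : ℕ) : ℤ := Mmat x n 0 0

/-- `s_n(x)`: bottom-left entry of `M_n(x)`. -/
def sF (x : ℝ) (n : ℕ) : ℤ := Mmat x n 1 0

/-- Ito's natural extension `F̄` of the Farey tent map. -/
def fareyNE (p : ℝ × ℝ) : ℝ × ℝ :=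
  if p.1 ≤ 1/2 then (p.1 / (1 - p.1), p.2 / (1 + p.2))
  else ((1 - p.1) / p.1, 1 / (1 + p.2))

/-- `Ω = [0,1]²`. -/
def OmegaSet : Set (ℝ × ℝ) := Set.Icc (0:ℝ) 1 ×ˢ Set.Icc (0:ℝ) 1

/-- The measure `μ̄` on `Ω` with density `(x + y − xy)⁻²` w.r.t. Lebesgue measure. -/
def muBar : Measure (ℝ × ℝ) :=
  (volume.restrict OmegaSet).withDensity
    (fun p => ENNReal.ofReal (1 / (p.1 + p.2 - p.1 * p.2) ^ 2))

/-- A proper inducible subregion of `Ω`. -/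
def ProperInducible (R : Set (ℝ × ℝ)) : Prop :=
  R ⊆ OmegaSet ∧ MeasurableSet R ∧ 0 < muBar R ∧ muBar R < ⊤ ∧ muBar (frontier R) = 0

/-- `hitsR R x k` holds iff `k ≥ 1` and `F̄^[k] (x,1) ∈ R`. -/
def hitsR (R : Set (ℝ × ℝ)) (x : ℝ) (k : ℕ) : Prop := 1 ≤ k ∧ fareyNE^[k] (x, 1) ∈ R

/-- `Nidx R x n = N_n`: `N_0 = 0` and, for `n ≥ 1`, the `n`-th smallest `k ≥ 1`
with `F̄^[k] (x,1) ∈ R`. -/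
def Nidx (R : Set (ℝ × ℝ)) (x : ℝ) : ℕ → ℕ
  | 0 => 0
  | n + 1 => Nat.nth (hitsR R x) n

/-- `h(x,y) = (1−y)/(x + y − xy)`. -/
def hIto (p : ℝ × ℝ) : ℝ := (1 - p.2) / (p.1 + p.2 - p.1 * p.2)

/-- `Θ_n(x) = s_n(x)·|s_n(x)·x − u_n(x)|`, the approximation coefficient of the
`n`-th Farey convergent `u_n(x)/s_n(x)`. -/
def ThetaF (x : ℝ) (n : ℕ) : ℝ := (sF x n : ℝ) * |(sF x n : ℝ) * x - (uF x n : ℝ)|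

/-- `Θ_n^R(x) = s_n^R·|s_n^R·x − u_n^R|` where `u_n^R = u_{N_n}(x)`, `s_n^R = s_{N_n}(x)`. -/
def ThetaR (R : Set (ℝ × ℝ)) (x : ℝ) (n : ℕ) : ℝ := ThetaF x (Nidx R x n)

/-- The Gauss map. -/
def gaussMap (x : ℝ) : ℝ := Int.fract (1 / x)

/-- `pquot x n` is the RCF partial quotient `a_{n+1}(x)`. -/
def pquot (x : ℝ) (n : ℕ) : ℤ := ⌊1 / (gaussMap^[n] x)⌋

/-- `pnum x (j+1)` is the RCF numerator `p_j(x)`; `pnum x 0 = p_{-1} = 1`. -/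
def pnum (x : ℝ) : ℕ → ℤ
  | 0 => 1
  | 1 => 0
  | n + 2 => pquot x n * pnum x (n + 1) + pnum x n

/-- `qden x (j+1)` is the RCF denominator `q_j(x)`; `qden x 0 = q_{-1} = 0`. -/
def qden (x : ℝ) : ℕ → ℤ
  | 0 => 0
  | 1 => 1
  | n + 2 => pquot x n * qden x (n + 1) + qden x n

/-- The approximation coefficient `Θ(x, p/q) = q·|q·x − p|`. -/
def Theta (x : ℝ) (p q : ℤ) : ℝ := (q : ℝ) * |(q : ℝ) * x - (p : ℝ)|

/-- `medTheta x l j = Θ(x, (l·p_j + p_{j−1})/(l·q_j + q_{j−1}))`. -/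
def medTheta (x : ℝ) (l : ℤ) (j : ℕ) : ℝ :=
  Theta x (l * pnum x (j + 1) + pnum x j) (l * qden x (j + 1) + qden x j)

end

lemma iterate_gaussMap_mem {x : ℝ} (hx : x ∈ Set.Ioo (0:ℝ) 1) (hirr : Irrational x) (n : ℕ) :
    gaussMap^[n] x ∈ Set.Ioo (0:ℝ) 1 ∧ Irrational (gaussMap^[n] x) := by
  induction n with
  | zero => exact ⟨hx, hirr⟩
  | succ n ih =>
    rw [Function.iterate_succ_apply']
    have h : Irrational (gaussMap (gaussMap^[n] x)) := by
      rw [gaussMap, one_div, Int.fract]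
      exact ih.2.inv.sub_intCast _
    exact ⟨⟨lt_of_le_of_ne (Int.fract_nonneg _) h.ne_zero.symm, Int.fract_lt_one _⟩, h⟩

lemma one_div_iterate_gaussMap (x : ℝ) (n : ℕ) :
    1 / gaussMap^[n] x = pquot x n + gaussMap^[n + 1] x := by
  rw [Function.iterate_succ_apply', gaussMap, pquot, Int.floor_add_fract]

lemma one_le_pquot {x : ℝ} (hx : x ∈ Set.Ioo (0:ℝ) 1) (hirr : Irrational x) (n : ℕ) :
    1 ≤ pquot x n := by
  obtain ⟨⟨h0, h1⟩, -⟩ := iterate_gaussMap_mem hx hirr n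
  rw [pquot, Int.le_floor, Int.cast_one]
  exact one_le_one_div h0 h1.le

lemma qden_nonneg_and_pos {x : ℝ} (hx : x ∈ Set.Ioo (0:ℝ) 1) (hirr : Irrational x) (n : ℕ) :
    0 ≤ qden x n ∧ 0 < qden x (n + 1) := by
  induction n with
  | zero => simp [qden]
  | succ n ih =>
    refine ⟨ih.2.le, ?_⟩
    have := one_le_pquot hx hirr n
    rw [qden]
    nlinarith

lemma qden_mul_sub_pnum_succ {x : ℝ} (hx : x ∈ Set.Ioo (0:ℝ) 1) (hirr : Irrational x) (n : ℕ) :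
    (qden x (n + 1) : ℝ) * x - pnum x (n + 1) =
      -(gaussMap^[n] x * (qden x n * x - pnum x n)) := by
  induction n with
  | zero => simp [qden, pnum]
  | succ n ih =>
    have h0 := (iterate_gaussMap_mem hx hirr n).1.1
    have h1 := one_div_iterate_gaussMap x n
    rw [div_eq_iff h0.ne'] at h1
    rw [qden, pnum]
    push_cast
    linear_combination (pquot x n + gaussMap^[n + 1] x) * ih + (qden x n * x - pnum x n) * h1

lemma abs_qden_mul_sub_pnum_mul {x : ℝ} (hx : x ∈ Set.Ioo (0:ℝ) 1) (hirr : Irrational x) (n : ℕ) :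
    |(qden x n : ℝ) * x - pnum x n| * (qden x (n + 1) + gaussMap^[n] x * qden x n) = 1 := by
  induction n with
  | zero => simp [qden, pnum]
  | succ n ih =>
    have h0 := (iterate_gaussMap_mem hx hirr n).1.1
    have h1 := one_div_iterate_gaussMap x n
    rw [div_eq_iff h0.ne'] at h1
    rw [qden_mul_sub_pnum_succ hx hirr, abs_neg, abs_mul, abs_of_pos h0, qden, ← ih]
    push_cast
    linear_combination -|(qden x n : ℝ) * x - pnum x n| * qden x (n + 1) * h1

/-- The approximation coefficient of an integer combination of two consecutive convergents. -/
lemma Theta_combination {x : ℝ} (hx : x ∈ Set.Ioo (0:ℝ) 1) (hirr : Irrational x) (n : ℕ)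
    (A B : ℤ) :
    Theta x (A * pnum x (n + 1) + B * pnum x n) (A * qden x (n + 1) + B * qden x n) *
        ((pquot x n + gaussMap^[n + 1] x) * qden x (n + 1) + qden x n) =
      (A * qden x (n + 1) + B * qden x n) * |B * (pquot x n + gaussMap^[n + 1] x) - A| := by
  have h0 := (iterate_gaussMap_mem hx hirr n).1.1
  have h1 := abs_qden_mul_sub_pnum_mul hx hirr n
  have h2 := qden_mul_sub_pnum_succ hx hirr n
  rw [Theta, ← one_div_iterate_gaussMap]
  push_cast
  generalize gaussMap^[n] x = t at *
  have e1 : ((A : ℝ) * qden x (n + 1) + B * qden x n) * x - (A * pnum x (n + 1) + B * pnum x n) =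
      t * (B * (1 / t) - A) * (qden x n * x - pnum x n) := by
    field_simp
    linear_combination A * h2
  rw [e1, abs_mul, abs_mul, abs_of_pos h0]
  have e2 : t * (1 / t) = 1 := mul_one_div_cancel h0.ne'
  linear_combination (A * qden x (n + 1) + B * qden x n) * |B * (1 / t) - A| * h1 +
    (A * qden x (n + 1) + B * qden x n) * |B * (1 / t) - A| * |(qden x n : ℝ) * x - pnum x n| *
      qden x (n + 1) * e2

/-- If neither coordinate with respect to a pair of adjacent intermediate fractions vanishes,
the approximation coefficient is at least `1`. -/
lemma one_le_Theta_of_lt_of_lt {x : ℝ} (hx : x ∈ Set.Ioo (0:ℝ) 1) (hirr : Irrational x) (n : ℕ)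
    {l r b : ℤ} (hl : 0 ≤ l) (hla : l < pquot x n) (hr : 1 ≤ r) (hb : 1 ≤ b) :
    1 ≤ Theta x ((l * (r + b) + r) * pnum x (n + 1) + (r + b) * pnum x n)
      ((l * (r + b) + r) * qden x (n + 1) + (r + b) * qden x n) := by
  have key := Theta_combination hx hirr n (l * (r + b) + r) (r + b)
  obtain ⟨hQ, hQ'⟩ := qden_nonneg_and_pos hx hirr n
  have ht := (iterate_gaussMap_mem hx hirr (n + 1)).1.1
  generalize Theta x _ _ = T at *
  push_cast at key
  rify at hl hr hb hQ hQ'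
  have hla' : (l : ℝ) + 1 ≤ pquot x n := by exact_mod_cast hla
  generalize (qden x n : ℝ) = Q at *
  generalize (qden x (n + 1) : ℝ) = Q' at *
  generalize gaussMap^[n + 1] x = t at *
  obtain ⟨σ, hσ⟩ : ∃ σ : ℝ, σ = pquot x n + t - l := ⟨_, rfl⟩
  have hσ1 : 1 ≤ σ := by linarith
  obtain ⟨e, he⟩ : ∃ e : ℝ, e = l * Q' + Q := ⟨_, rfl⟩
  have he0 : 0 ≤ e := by rw [he]; positivity
  have e1 : ((r : ℝ) + b) * (pquot x n + t) - (l * (r + b) + r) = b * σ + r * (σ - 1) := by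
    rw [hσ]; ring
  have e2 : ((l : ℝ) * (r + b) + r) * Q' + (r + b) * Q = (r + b) * e + r * Q' := by
    rw [he]; ring
  have e3 : ((pquot x n : ℝ) + t) * Q' + Q = σ * Q' + e := by rw [hσ, he]; ring
  have hy : σ ≤ b * σ + r * (σ - 1) := by nlinarith
  have hX : 2 * e + Q' ≤ (r + b) * e + r * Q' := by nlinarith
  rw [e1, e2, e3, abs_of_nonneg (by linarith)] at key
  have hpos : 0 < σ * Q' + e := by positivity
  have : (2 * e + Q') * σ ≤ ((r + b) * e + r * Q') * (b * σ + r * (σ - 1)) :=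
    mul_le_mul hX hy (by linarith) (by linarith)
  by_contra! hT
  nlinarith

/-- A nonnegative coprime combination of consecutive convergents with approximation coefficient
less than `1` is an intermediate fraction. -/
lemma exists_intermediate_of_Theta_lt_one {x : ℝ} (hx : x ∈ Set.Ioo (0:ℝ) 1) (hirr : Irrational x)
    (n : ℕ) {A B : ℤ} (hA : 0 ≤ A) (hB : 0 ≤ B) (hAB : IsCoprime A B)
    (hT : Theta x (A * pnum x (n + 1) + B * pnum x n) (A * qden x (n + 1) + B * qden x n) < 1) :
    ∃ (m : ℕ) (l : ℤ), 0 ≤ l ∧ l < pquot x m ∧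
      A * pnum x (n + 1) + B * pnum x n = l * pnum x (m + 1) + pnum x m ∧
      A * qden x (n + 1) + B * qden x n = l * qden x (m + 1) + qden x m := by
  induction hN : (A + B).toNat using Nat.strong_induction_on generalizing n A B with
  | _ N ih =>
  have ha := one_le_pquot hx hirr n
  rcases hB.eq_or_lt with rfl | hB'
  · have hA1 : A = 1 := by
      rcases Int.isUnit_iff.1 (isCoprime_zero_right.1 hAB) with h | h <;> omega
    exact ⟨n + 1, 0, le_rfl, one_le_pquot hx hirr (n + 1), by simp [hA1], by simp [hA1]⟩
  by_cases hc : pquot x n * B ≤ A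
  · have hp : A * pnum x (n + 1) + B * pnum x n =
        B * pnum x (n + 1 + 1) + (A - pquot x n * B) * pnum x (n + 1) := by
      rw [pnum]; ring
    have hq : A * qden x (n + 1) + B * qden x n =
        B * qden x (n + 1 + 1) + (A - pquot x n * B) * qden x (n + 1) := by
      rw [qden]; ring
    rw [hp, hq] at hT ⊢
    refine ih _ ?_ (n + 1) hB (by linarith) ?_ hT rfl
    · have : B ≤ pquot x n * B := by nlinarith
      omega
    · rw [(by ring : A - pquot x n * B = A + B * -pquot x n)]
      exact hAB.symm.add_mul_left_right _
  · push Not at hc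
    have hdiv : A = A / B * B + A % B := (Int.ediv_mul_add_emod A B).symm
    have hl : 0 ≤ A / B := Int.ediv_nonneg hA hB
    have hla : A / B < pquot x n := Int.ediv_lt_of_lt_mul hB' hc
    have hr0 : 0 ≤ A % B := Int.emod_nonneg _ hB'.ne'
    have hrB : A % B < B := Int.emod_lt_of_pos _ hB'
    rcases hr0.eq_or_lt with hr | hr
    · have hB1 : B = 1 := by
        have := hAB.symm.isUnit_of_dvd' dvd_rfl (Int.dvd_of_emod_eq_zero hr.symm)
        rcases Int.isUnit_iff.1 this with h | h <;> omega
      subst hB1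
      exact ⟨n, A, hA, by simpa using hc, by ring, by ring⟩
    · have := one_le_Theta_of_lt_of_lt hx hirr n hl hla (r := A % B) (b := B - A % B)
        hr (by omega)
      rw [add_sub_cancel, ← hdiv] at this
      linarith

/-- If `k/(k+1) ≤ Θ(x,p/q) < (k+1)/(k+2)` then `p/q` is a RCF convergent `p_{j−1}/q_{j−1}` with
`a_j = 1 ∧ a_{j+1} ≥ k`, or a first mediant with `a_{j+1} ≤ k+1`, or a final mediant with
`a_{j+1} ≤ k+1`. -/
theorem stmt_12 (k : ℕ) (hk : 1 ≤ k) (x : ℝ) (hx : x ∈ Set.Ioo (0:ℝ) 1) (hirr : Irrational x)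
    (p q : ℤ) (hq : 0 < q) (hcop : Int.gcd p q = 1)
    (hpq0 : 0 < (p:ℝ) / (q:ℝ)) (hpq1 : (p:ℝ) / (q:ℝ) < 1)
    (h1 : (k:ℝ) / ((k:ℝ) + 1) ≤ (q:ℝ) * |(q:ℝ) * x - (p:ℝ)|)
    (h2 : (q:ℝ) * |(q:ℝ) * x - (p:ℝ)| < ((k:ℝ) + 1) / ((k:ℝ) + 2)) :
    (∃ j : ℕ, 1 ≤ j ∧ pquot x (j - 1) = 1 ∧ (k : ℤ) ≤ pquot x j ∧
        (p:ℝ) / (q:ℝ) = (pnum x j : ℝ) / (qden x j : ℝ)) ∨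
    (∃ j : ℕ, pquot x j ≤ (k : ℤ) + 1 ∧
        (p:ℝ) / (q:ℝ) = ((pnum x (j + 1) + pnum x j : ℤ) : ℝ) /
          ((qden x (j + 1) + qden x j : ℤ) : ℝ)) ∨
    (∃ j : ℕ, pquot x j ≤ (k : ℤ) + 1 ∧
        (p:ℝ) / (q:ℝ) = (((pquot x j - 1) * pnum x (j + 1) + pnum x j : ℤ) : ℝ) /
          (((pquot x j - 1) * qden x (j + 1) + qden x j : ℤ) : ℝ)) := by
  have hqR : (0 : ℝ) < q := by exact_mod_cast hq
  have hp : 0 < p := by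
    have := (div_pos_iff_of_pos_right hqR).1 hpq0
    exact_mod_cast this
  have hkR : (1 : ℝ) ≤ k := by exact_mod_cast hk
  have hT1 : ((k : ℝ) + 1) / (k + 2) < 1 := by rw [div_lt_one (by positivity)]; linarith
  have hp0 : q * pnum x (0 + 1) + p * pnum x 0 = p := by simp [pnum]
  have hq0 : q * qden x (0 + 1) + p * qden x 0 = q := by simp [qden]
  obtain ⟨m, l, hl0, hla, hpl, hql⟩ := exists_intermediate_of_Theta_lt_one hx hirr 0 hq.le hp.le
    (Int.isCoprime_iff_gcd_eq_one.2 hcop).symm (by rw [hp0, hq0]; exact h2.trans hT1)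
  rw [hp0] at hpl
  rw [hq0] at hql
  have key := Theta_combination hx hirr m l 1
  rw [one_mul, one_mul, ← hpl, ← hql] at key
  obtain ⟨hQ, hQ'⟩ := qden_nonneg_and_pos hx hirr m
  obtain ⟨ht0, ht1⟩ := (iterate_gaussMap_mem hx hirr (m + 1)).1
  change _ ≤ Theta x p q at h1
  change Theta x p q < _ at h2
  rw [div_le_iff₀ (by positivity)] at h1
  have h3 := h2.trans hT1
  rw [lt_div_iff₀ (by positivity)] at h2
  generalize Theta x p q = T at *
  obtain ⟨y, hy⟩ : ∃ y : ℝ, y = pquot x m + gaussMap^[m + 1] x - l := ⟨_, rfl⟩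
  obtain ⟨X, hX⟩ : ∃ X : ℝ, X = l * qden x (m + 1) + qden x m := ⟨_, rfl⟩
  have hlaR : (l : ℝ) + 1 ≤ pquot x m := by exact_mod_cast hla
  have hl0R : (0 : ℝ) ≤ l := by exact_mod_cast hl0
  have hQR : (0 : ℝ) ≤ qden x m := by exact_mod_cast hQ
  have hQR' : (0 : ℝ) < qden x (m + 1) := by exact_mod_cast hQ'
  have hy1 : 1 ≤ y := by linarith
  have hX0 : 0 ≤ X := by rw [hX]; positivity
  -- `1 / T = 1 / y + Q / X`, where `Q` is the denominator of the `m`-th convergent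
  have key' : T * (y * qden x (m + 1) + X) = X * y := by
    have e1 : (1 : ℤ) * ((pquot x m : ℝ) + gaussMap^[m + 1] x) - l = y := by
      rw [hy]; push_cast; ring
    rw [e1, abs_of_nonneg (by linarith)] at key
    rw [hX]
    push_cast at key
    linear_combination key + T * qden x (m + 1) * hy
  have hpos : 0 < y * qden x (m + 1) + X := by positivity
  rcases (by omega : l = 0 ∨ l = 1 ∨ l = pquot x m - 1 ∨ (2 ≤ l ∧ l + 2 ≤ pquot x m)) with
    rfl | rfl | rfl | ⟨hl2, hla2⟩
  · left
    obtain _ | j := m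
    · simp [qden] at hql
      omega
    have hpq : (p : ℝ) / q = (pnum x (j + 1) : ℝ) / qden x (j + 1) := by
      rw [hpl, hql]; simp
    have hXQ : X = qden x (j + 1) := by rw [hX]; simp
    have hX1 : 0 < X := by rw [hXQ]; exact_mod_cast (qden_nonneg_and_pos hx hirr j).2
    have hQj : (0 : ℝ) ≤ qden x j := by exact_mod_cast (qden_nonneg_and_pos hx hirr j).1
    have hrec : (qden x (j + 1 + 1) : ℝ) = pquot x j * X + qden x j := by
      rw [hXQ, qden]; push_cast; ring
    have hineq : k * (y * qden x (j + 1 + 1) + X) ≤ (k + 1) * (X * y) := by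
      rw [← key']; linarith [mul_le_mul_of_nonneg_right h1 hpos.le]
    have haj := one_le_pquot hx hirr j
    have hXy : 0 < X * y := by positivity
    have haj1 : pquot x j = 1 := by
      by_contra hne
      have h2j : (2 : ℝ) ≤ pquot x j := by exact_mod_cast (by omega : 2 ≤ pquot x j)
      have hQ2 : 2 * X ≤ qden x (j + 1 + 1) := by rw [hrec]; nlinarith
      have h4 : k * (y * (2 * X) + X) ≤ k * (y * qden x (j + 1 + 1) + X) := by gcongr
      have h5 : 0 < k * X := by positivity
      nlinarith
    refine ⟨j + 1, by omega, haj1, ?_, hpq⟩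
    have hQ1 : X ≤ qden x (j + 1 + 1) := by rw [hrec, haj1]; push_cast; linarith
    have h4 : k * (y * X + X) ≤ k * (y * qden x (j + 1 + 1) + X) := by gcongr
    have h5 : (k : ℝ) ≤ y := by
      by_contra! hlt
      nlinarith
    have h6 : ((k : ℤ) : ℝ) < ((pquot x (j + 1) + 1 : ℤ) : ℝ) := by
      push_cast at hy ⊢
      linarith
    have h7 : (k : ℤ) < pquot x (j + 1) + 1 := by exact_mod_cast h6
    omega
  · right; left
    refine ⟨m, ?_, by rw [hpl, hql, one_mul, one_mul]⟩
    by_contra! hlt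
    have hak : (k : ℝ) + 2 ≤ pquot x m := by
      exact_mod_cast (by omega : (k : ℤ) + 2 ≤ pquot x m)
    push_cast at hy hX
    have hyk : (k : ℝ) + 1 ≤ y := by linarith
    have hXQ : (qden x (m + 1) : ℝ) ≤ X := by linarith
    have h4 : (k + 2) * (X * y) < (k + 1) * (y * qden x (m + 1) + X) := by
      rw [← key']; linarith [mul_lt_mul_of_pos_right h2 hpos]
    have h5 : 0 ≤ (k + 1) * (y * (X - qden x (m + 1))) := by
      have := sub_nonneg.2 hXQ
      positivity
    have h6 : 0 ≤ X * (y - (k + 1)) := mul_nonneg hX0 (by linarith)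
    linarith
  · right; right
    refine ⟨m, ?_, by rw [hpl, hql]⟩
    by_contra! hlt
    have hak : (k : ℝ) + 2 ≤ pquot x m := by
      exact_mod_cast (by omega : (k : ℤ) + 2 ≤ pquot x m)
    push_cast at hX
    have hXQ : (k + 1) * (qden x (m + 1) : ℝ) ≤ X := by nlinarith
    have h4 : (k + 2) * (X * y) < (k + 1) * (y * qden x (m + 1) + X) := by
      rw [← key']; linarith [mul_lt_mul_of_pos_right h2 hpos]
    have h5 : 0 ≤ y * (X - (k + 1) * qden x (m + 1)) := mul_nonneg (by linarith) (by linarith)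
    have h6 : 0 ≤ (k + 1) * (X * (y - 1)) := by
      have := sub_nonneg.2 hy1
      positivity
    linarith
  · exfalso
    have hl2R : (2 : ℝ) ≤ l := by exact_mod_cast hl2
    have hla2R : (l : ℝ) + 2 ≤ pquot x m := by exact_mod_cast hla2
    have hy2 : 2 ≤ y := by linarith
    have hXQ : 2 * (qden x (m + 1) : ℝ) ≤ X := by
      linarith [mul_le_mul_of_nonneg_right hl2R hQR'.le]
    have h4 : X * y < y * qden x (m + 1) + X := by
      rw [← key']; linarith [mul_lt_mul_of_pos_right h3 hpos]
    have h5 : 0 ≤ y * (X - 2 * qden x (m + 1)) := mul_nonneg (by linarith) (by linarith)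
    have h6 : 0 ≤ X * (y - 2) := mul_nonneg hX0 (by linarith)
    linarith
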